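/- Let α ∈ (0, 1) ∪ (1, ∞), and let ρ, σ be positive semidefinite complex n×n matrices with ρ ≠ 0 and Tr[ρ] ≥ Tr[σ]. Then D̃_α(ρ‖σ) ≥ 0. Furthermore, if ρ = σ then D̃_α(ρ‖σ) = 0. -/

import Mathlib

open Matrix
open scoped Kronecker Classical ComplexOrder

/-- Real power of a matrix via functional calculus on the eigenvalues of a Hermitian
matrix, with the convention that eigenvalue `0` is mapped to `0` (powers are taken on
the support). Non-Hermitian matrices are mapped to `0`. -/
noncomputable def matPow {n : Type*} [Fintype n] [DecidableEq n]
    (A : Matrix n n ℂ) (t : ℝ) : Matrix n n ℂ :=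
  if hA : A.IsHermitian then
    (hA.eigenvectorUnitary : Matrix n n ℂ) *
      Matrix.diagonal (fun i =>
        ((if hA.eigenvalues i = 0 then (0 : ℝ) else hA.eigenvalues i ^ t : ℝ) : ℂ)) *
      (star (hA.eigenvectorUnitary : Matrix n n ℂ))
  else 0

/-- `dominates σ ρ` (written `σ ≫ ρ` in the paper): the kernel of `σ` is contained in
the kernel of `ρ`. -/
def dominates {n : Type*} [Fintype n] (σ ρ : Matrix n n ℂ) : Prop :=
  ∀ v : n → ℂ, σ.mulVec v = 0 → ρ.mulVec v = 0

/-- The sandwiched Rényi divergence of order `α`, with values in `ℝ ∪ {+∞}` (as a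
subset of `EReal`), logarithms base 2. It is `+∞` unless `ρ` is not orthogonal to `σ`
(i.e. `Tr[ρσ] ≠ 0`) and (`σ ≫ ρ` or `α < 1`). -/
noncomputable def Dtilde {n : Type*} [Fintype n] [DecidableEq n]
    (α : ℝ) (ρ σ : Matrix n n ℂ) : EReal :=
  if (ρ * σ).trace ≠ 0 ∧ (dominates σ ρ ∨ α < 1) then
    (((α - 1)⁻¹ * Real.logb 2
        ((matPow (matPow σ ((1 - α) / (2 * α)) * ρ * matPow σ ((1 - α) / (2 * α))) α).trace.re
          / ρ.trace.re) : ℝ) : EReal)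
  else ⊤

/-- The scalar function `x ↦ x ^ t` with the convention `0 ^ t = 0` for every exponent. -/
noncomputable def supportRpow (t x : ℝ) : ℝ := if x = 0 then 0 else x ^ t

theorem supportRpow_nonneg (t : ℝ) {x : ℝ} (hx : 0 ≤ x) : 0 ≤ supportRpow t x := by
  unfold supportRpow
  split_ifs
  · exact le_rfl
  · exact Real.rpow_nonneg hx t

theorem supportRpow_add (s t : ℝ) {x : ℝ} (hx : 0 ≤ x) :
    supportRpow (s + t) x = supportRpow s x * supportRpow t x := by
  unfold supportRpow
  split_ifs with h
  · simp
  · exact Real.rpow_add (lt_of_le_of_ne hx (Ne.symm h)) s t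

theorem supportRpow_mul (s t : ℝ) {x : ℝ} (hx : 0 ≤ x) :
    supportRpow (s * t) x = supportRpow t (supportRpow s x) := by
  rcases hx.eq_or_lt with rfl | h
  · simp [supportRpow]
  · simp [supportRpow, h.ne', (Real.rpow_pos_of_pos h s).ne', Real.rpow_mul hx]

theorem supportRpow_one (x : ℝ) : supportRpow 1 x = x := by
  unfold supportRpow
  split_ifs with h <;> simp [h]

theorem rpow_mul_rpow_aux {α : ℝ} (hα : 0 < α) {x y : ℝ} (hx : 0 ≤ x) (hy : 0 < y) :
    y * (x * y ^ (-α⁻¹)) = x * y ^ ((α - 1) / α) ∧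
      y * (x * y ^ (-α⁻¹)) ^ α = supportRpow α x := by
  constructor
  · rw [show (α - 1) / α = 1 + -α⁻¹ by field_simp; ring, Real.rpow_add hy, Real.rpow_one]
    ring
  · rw [Real.mul_rpow hx (Real.rpow_nonneg hy.le _), ← Real.rpow_mul hy.le,
      show -α⁻¹ * α = -1 by field_simp, Real.rpow_neg_one, supportRpow]
    split_ifs with h
    · simp [h, Real.zero_rpow hα.ne']
    · field_simp

theorem mul_supportRpow_le {α : ℝ} (hα : 1 < α) {x y : ℝ} (hx : 0 ≤ x) (hy : 0 ≤ y) :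
    x * supportRpow ((α - 1) / α) y ≤ α⁻¹ * supportRpow α x + (1 - α⁻¹) * y := by
  have hα0 : 0 < α := one_pos.trans hα
  rcases hy.eq_or_lt with rfl | hy
  · simpa [supportRpow] using mul_nonneg (inv_nonneg.2 hα0.le) (supportRpow_nonneg α hx)
  obtain ⟨h1, h2⟩ := rpow_mul_rpow_aux hα0 hx hy
  rw [supportRpow, if_neg hy.ne', ← h1, ← h2]
  have hu : 0 ≤ x * y ^ (-α⁻¹) := mul_nonneg hx (Real.rpow_nonneg hy.le _)
  have := one_add_mul_self_le_rpow_one_add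
    (show -1 ≤ x * y ^ (-α⁻¹) - 1 by linarith) hα.le
  rw [add_sub_cancel] at this
  have := mul_le_mul_of_nonneg_left this (mul_nonneg (inv_nonneg.2 hα0.le) hy.le)
  have hc : α⁻¹ * α = 1 := inv_mul_cancel₀ hα0.ne'
  linear_combination this + y * (1 - x * y ^ (-α⁻¹)) * hc

theorem le_mul_supportRpow {α : ℝ} (hα0 : 0 < α) (hα : α < 1) {x y : ℝ} (hx : 0 ≤ x)
    (hy : 0 ≤ y) (hxy : y = 0 → x = 0) :
    α⁻¹ * supportRpow α x ≤ x * supportRpow ((α - 1) / α) y + (α⁻¹ - 1) * y := by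
  rcases hy.eq_or_lt with rfl | hy
  · simp [supportRpow, hxy rfl]
  obtain ⟨h1, h2⟩ := rpow_mul_rpow_aux hα0 hx hy
  rw [supportRpow.eq_def _ y, if_neg hy.ne', ← h1, ← h2]
  have hu : 0 ≤ x * y ^ (-α⁻¹) := mul_nonneg hx (Real.rpow_nonneg hy.le _)
  have := rpow_one_add_le_one_add_mul_self
    (show -1 ≤ x * y ^ (-α⁻¹) - 1 by linarith) hα0.le hα.le
  rw [add_sub_cancel] at this
  have := mul_le_mul_of_nonneg_left this (mul_nonneg (inv_nonneg.2 hα0.le) hy.le)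
  have hc : α⁻¹ * α = 1 := inv_mul_cancel₀ hα0.ne'
  linear_combination this - y * (1 - x * y ^ (-α⁻¹)) * hc

section MatPow

variable {n : Type*} [Fintype n] [DecidableEq n] {A B : Matrix n n ℂ}

theorem matPow_eq_cfc (hA : A.IsHermitian) (t : ℝ) : matPow A t = cfc (supportRpow t) A := by
  rw [hA.cfc_eq, matPow, dif_pos hA]
  rfl

theorem Matrix.continuousOn_spectrum (A : Matrix n n ℂ) (f : ℝ → ℝ) :
    ContinuousOn f (spectrum ℝ A) :=
  (Matrix.finite_real_spectrum (A := A)).continuousOn f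

theorem Matrix.PosSemidef.nonneg_of_mem_spectrum_real (hA : A.PosSemidef) {x : ℝ}
    (hx : x ∈ spectrum ℝ A) : 0 ≤ x := by
  obtain ⟨i, rfl⟩ := hA.1.spectrum_real_eq_range_eigenvalues ▸ hx
  exact hA.eigenvalues_nonneg i

theorem matPow_isHermitian (A : Matrix n n ℂ) (t : ℝ) : (matPow A t).IsHermitian := by
  by_cases hA : A.IsHermitian
  · rw [matPow_eq_cfc hA]
    exact cfc_predicate (supportRpow t) A
  · simp [matPow, hA]

theorem matPow_mul_matPow (hA : A.PosSemidef) (s t : ℝ) :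
    matPow A s * matPow A t = matPow A (s + t) := by
  simp only [matPow_eq_cfc hA.1]
  rw [← cfc_mul _ _ _ (A.continuousOn_spectrum _) (A.continuousOn_spectrum _)]
  exact cfc_congr fun x hx => (supportRpow_add s t (hA.nonneg_of_mem_spectrum_real hx)).symm

theorem matPow_matPow (hA : A.PosSemidef) (s t : ℝ) :
    matPow (matPow A s) t = matPow A (s * t) := by
  rw [matPow_eq_cfc (matPow_isHermitian A s), matPow_eq_cfc hA.1, matPow_eq_cfc hA.1,
    ← cfc_comp _ _ _ hA.1.isSelfAdjoint (((Matrix.finite_real_spectrum (A := A)).image _).continuousOn _)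
      (A.continuousOn_spectrum _)]
  exact cfc_congr fun x hx => (supportRpow_mul s t (hA.nonneg_of_mem_spectrum_real hx)).symm

theorem matPow_one (hA : A.IsHermitian) : matPow A 1 = A := by
  rw [matPow_eq_cfc hA, funext supportRpow_one]
  exact cfc_id' ℝ A hA

theorem trace_cfc (hA : A.IsHermitian) (f : ℝ → ℝ) :
    (cfc f A).trace.re = ∑ i, f (hA.eigenvalues i) := by
  rw [hA.cfc_eq, Matrix.IsHermitian.cfc, Unitary.conjStarAlgAut_apply, Matrix.trace_mul_cycle,
    Unitary.coe_star_mul_self]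
  simp [Matrix.trace]

/-- The overlaps of the eigenbases of two Hermitian matrices. -/
theorem exists_trace_cfc_mul_cfc (hA : A.IsHermitian) (hB : B.IsHermitian) :
    ∃ w : n → n → ℝ, (∀ i j, 0 ≤ w i j) ∧ ∀ f g : ℝ → ℝ,
      (cfc f A * cfc g B).trace.re =
        ∑ i, ∑ j, w i j * (f (hA.eigenvalues i) * g (hB.eigenvalues j)) := by
  set U : Matrix n n ℂ := (hA.eigenvectorUnitary : Matrix n n ℂ)
  set V : Matrix n n ℂ := (hB.eigenvectorUnitary : Matrix n n ℂ)
  refine ⟨fun i j => Complex.normSq ((star U * V) i j), fun i j => Complex.normSq_nonneg _,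
    fun f g => ?_⟩
  set a : Matrix n n ℂ := diagonal (RCLike.ofReal ∘ f ∘ hA.eigenvalues) with ha
  set b : Matrix n n ℂ := diagonal (RCLike.ofReal ∘ g ∘ hB.eigenvalues) with hb
  have h : (cfc f A * cfc g B).trace = (a * (star U * V) * (b * star (star U * V))).trace := by
    rw [hA.cfc_eq, hB.cfc_eq, Matrix.IsHermitian.cfc, Matrix.IsHermitian.cfc,
      Unitary.conjStarAlgAut_apply, Unitary.conjStarAlgAut_apply]
    change (U * a * star U * (V * b * star V)).trace = _
    rw [show U * a * star U * (V * b * star V) = U * (a * star U * V * b * star V) by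
      simp only [Matrix.mul_assoc], Matrix.trace_mul_comm]
    simp only [star_mul, star_star, Matrix.mul_assoc]
  rw [h, Matrix.trace, Complex.re_sum]
  refine Finset.sum_congr rfl fun i _ => ?_
  rw [Matrix.diag_apply, Matrix.mul_apply, Complex.re_sum]
  refine Finset.sum_congr rfl fun j _ => ?_
  rw [ha, hb, Matrix.diagonal_mul, Matrix.diagonal_mul, Matrix.star_apply]
  simp [Complex.normSq_apply]
  ring

/-- A pointwise inequality between eigenvalues yields a trace inequality, provided it holds for
all pairs of eigenvalues whose eigenvectors are not orthogonal. -/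
theorem trace_inequality (hA : A.PosSemidef) (hB : B.PosSemidef) (e f g h : ℝ → ℝ)
    (p q : ℝ → ℝ) (hp : ∀ x, 0 ≤ x → 0 ≤ p x) (hq : ∀ y, 0 ≤ y → 0 ≤ q y)
    (hpq : (cfc p A * cfc q B).trace.re = 0)
    (hle : ∀ x y, 0 ≤ x → 0 ≤ y → p x * q y = 0 → e x * f y ≤ g x + h y) :
    (cfc e A * cfc f B).trace.re ≤ (cfc g A).trace.re + (cfc h B).trace.re := by
  obtain ⟨w, hw, H⟩ := exists_trace_cfc_mul_cfc hA.1 hB.1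
  have hg := H g (fun _ => 1)
  have hh := H (fun _ => 1) h
  rw [cfc_const_one ℝ B hB.1.isSelfAdjoint, Matrix.mul_one] at hg
  rw [cfc_const_one ℝ A hA.1.isSelfAdjoint, Matrix.one_mul] at hh
  rw [H] at hpq ⊢
  rw [hg, hh, ← Finset.sum_add_distrib]
  refine Finset.sum_le_sum fun i _ => ?_
  rw [← Finset.sum_add_distrib]
  refine Finset.sum_le_sum fun j _ => ?_
  have hx := hA.eigenvalues_nonneg i
  have hterm : ∀ i j, 0 ≤ w i j * (p (hA.1.eigenvalues i) * q (hB.1.eigenvalues j)) :=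
    fun i j => mul_nonneg (hw i j)
      (mul_nonneg (hp _ (hA.eigenvalues_nonneg i)) (hq _ (hB.eigenvalues_nonneg j)))
  have hz := (Finset.sum_eq_zero_iff_of_nonneg
    fun i _ => Finset.sum_nonneg fun j _ => hterm i j).1 hpq i (Finset.mem_univ _)
  have hz' := (Finset.sum_eq_zero_iff_of_nonneg fun j _ => hterm i j).1 hz j (Finset.mem_univ _)
  rcases mul_eq_zero.1 hz' with h0 | h0
  · simp [h0]
  · have := mul_le_mul_of_nonneg_left (hle _ _ hx (hB.eigenvalues_nonneg j) h0) (hw i j)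
    linarith

theorem trace_cfc_const_mul (hA : A.IsHermitian) (c : ℝ) (f : ℝ → ℝ) :
    (cfc (fun x => c * f x) A).trace.re = c * (cfc f A).trace.re := by
  rw [trace_cfc hA, trace_cfc hA, Finset.mul_sum]

/-- Young's inequality for traces. -/
theorem trace_mul_matPow_le (hA : A.PosSemidef) (hB : B.PosSemidef) {α : ℝ} (hα : 1 < α) :
    (A * matPow B ((α - 1) / α)).trace.re ≤
      α⁻¹ * (matPow A α).trace.re + (1 - α⁻¹) * B.trace.re := by
  have h := trace_inequality hA hB (fun x => x) (supportRpow ((α - 1) / α))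
    (fun x => α⁻¹ * supportRpow α x) (fun y => (1 - α⁻¹) * y) (fun _ => 0) (fun _ => 0)
    (fun _ _ => le_rfl) (fun _ _ => le_rfl) (by simp)
    fun x y hx hy _ => mul_supportRpow_le hα hx hy
  rwa [trace_cfc_const_mul hA.1, trace_cfc_const_mul hB.1, cfc_id' ℝ A hA.1.isSelfAdjoint,
    cfc_id' ℝ B hB.1.isSelfAdjoint, ← matPow_eq_cfc hA.1, ← matPow_eq_cfc hB.1] at h

/-- The reverse Young inequality for traces. -/
theorem trace_matPow_le (hA : A.PosSemidef) (hB : B.PosSemidef) (hAB : A * matPow B 0 = A)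
    {α : ℝ} (hα0 : 0 < α) (hα : α < 1) :
    α⁻¹ * (matPow A α).trace.re ≤
      (A * matPow B ((α - 1) / α)).trace.re + (α⁻¹ - 1) * B.trace.re := by
  have hq : cfc (fun y : ℝ => 1 - supportRpow 0 y) B = 1 - matPow B 0 := by
    rw [cfc_sub _ _ _ (B.continuousOn_spectrum _) (B.continuousOn_spectrum _),
      cfc_const_one ℝ B hB.1.isSelfAdjoint, matPow_eq_cfc hB.1]
  have h := trace_inequality hA hB (fun x => -x) (supportRpow ((α - 1) / α))
    (fun x => -α⁻¹ * supportRpow α x) (fun y => (α⁻¹ - 1) * y) (fun x => x)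
    (fun y => 1 - supportRpow 0 y) (fun _ hx => hx)
    (fun y _ => by unfold supportRpow; split_ifs <;> simp)
    (by rw [hq, cfc_id' ℝ A hA.1.isSelfAdjoint, Matrix.mul_sub, hAB, Matrix.mul_one, sub_self]
        simp)
    fun x y hx hy hxy => by
      have := le_mul_supportRpow hα0 hα hx hy fun h => by simpa [supportRpow, h] using hxy
      linarith
  rw [trace_cfc_const_mul hA.1, trace_cfc_const_mul hB.1, cfc_neg_id A hA.1.isSelfAdjoint,
    cfc_id' ℝ B hB.1.isSelfAdjoint, ← matPow_eq_cfc hA.1, ← matPow_eq_cfc hB.1, Matrix.neg_mul,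
    Matrix.trace_neg, Complex.neg_re] at h
  linarith

theorem mul_matPow_zero_of_dominates (hB : B.PosSemidef) (h : dominates B A) :
    A * matPow B 0 = A := by
  have hBP : B * (1 - matPow B 0) = 0 := by
    have := matPow_mul_matPow hB 1 0
    rw [add_zero, matPow_one hB.1] at this
    rw [Matrix.mul_sub, this, Matrix.mul_one, sub_self]
  have hAP : A * (1 - matPow B 0) = 0 := by
    refine Matrix.ext_of_mulVec_single fun i => ?_
    rw [← Matrix.mulVec_mulVec, Matrix.zero_mulVec]
    apply h
    rw [Matrix.mulVec_mulVec, hBP, Matrix.zero_mulVec]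
  rw [Matrix.mul_sub, Matrix.mul_one] at hAP
  exact (sub_eq_zero.1 hAP).symm

theorem trace_mul_matPow_zero_le (hA : A.PosSemidef) (hB : B.PosSemidef) :
    (A * matPow B 0).trace.re ≤ A.trace.re := by
  have hP : matPow B 0 * matPow B 0 = matPow B 0 := by simpa using matPow_mul_matPow hB 0 0
  have h := (hA.conjTranspose_mul_mul_same (1 - matPow B 0)).trace_nonneg
  have hH : (1 - matPow B 0)ᴴ = 1 - matPow B 0 := by
    rw [Matrix.conjTranspose_sub, Matrix.conjTranspose_one, (matPow_isHermitian B 0).eq]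
  have hI : (1 - matPow B 0) * (1 - matPow B 0) = 1 - matPow B 0 := by
    simp [Matrix.mul_sub, Matrix.sub_mul, hP]
  rw [hH, Matrix.trace_mul_cycle, hI, Matrix.trace_mul_comm, Matrix.mul_sub, Matrix.mul_one,
    Matrix.trace_sub] at h
  simpa using (Complex.le_def.1 h).1

theorem trace_matPow_nonneg (hA : A.PosSemidef) (t : ℝ) : 0 ≤ (matPow A t).trace.re := by
  rw [matPow_eq_cfc hA.1, trace_cfc hA.1]
  exact Finset.sum_nonneg fun i _ => supportRpow_nonneg t (hA.eigenvalues_nonneg i)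

theorem trace_sandwich_mul_matPow (A : Matrix n n ℂ) (hB : B.PosSemidef) {α : ℝ} (hα : α ≠ 0) :
    (matPow B ((1 - α) / (2 * α)) * A * matPow B ((1 - α) / (2 * α)) *
      matPow B ((α - 1) / α)).trace = (A * matPow B 0).trace := by
  rw [Matrix.mul_assoc, matPow_mul_matPow hB, Matrix.trace_mul_cycle, matPow_mul_matPow hB,
    Matrix.trace_mul_comm]
  congr 3
  field_simp
  ring

theorem posSemidef_sandwich (hA : A.PosSemidef) (B : Matrix n n ℂ) (t : ℝ) :
    (matPow B t * A * matPow B t).PosSemidef := by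
  simpa [(matPow_isHermitian B t).eq] using hA.mul_mul_conjTranspose_same (matPow B t)

theorem matPow_sandwich_self (hA : A.PosSemidef) {α : ℝ} (hα : α ≠ 0) :
    matPow (matPow A ((1 - α) / (2 * α)) * A * matPow A ((1 - α) / (2 * α))) α = A := by
  have h : matPow A ((1 - α) / (2 * α)) * A * matPow A ((1 - α) / (2 * α)) = matPow A α⁻¹ := by
    nth_rw 2 [← matPow_one hA.1]
    rw [matPow_mul_matPow hA, matPow_mul_matPow hA]
    congr 1
    field_simp
    ring
  rw [h, matPow_matPow hA, inv_mul_cancel₀ hα, matPow_one hA.1]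

theorem trace_le_trace_sandwich (hA : A.PosSemidef) (hB : B.PosSemidef) (hAB : dominates B A)
    (htr : B.trace.re ≤ A.trace.re) {α : ℝ} (hα : 1 < α) :
    A.trace.re ≤ (matPow (matPow B ((1 - α) / (2 * α)) * A *
      matPow B ((1 - α) / (2 * α))) α).trace.re := by
  have hα0 : 0 < α := one_pos.trans hα
  have h := trace_mul_matPow_le (posSemidef_sandwich hA B ((1 - α) / (2 * α))) hB hα
  rw [trace_sandwich_mul_matPow A hB hα0.ne', mul_matPow_zero_of_dominates hB hAB] at h
  have h1 := mul_le_mul_of_nonneg_left htr (sub_nonneg.2 (inv_le_one_of_one_le₀ hα.le))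
  exact le_of_mul_le_mul_left (by linarith) (inv_pos.2 hα0)

theorem trace_sandwich_le_trace (hA : A.PosSemidef) (hB : B.PosSemidef)
    (htr : B.trace.re ≤ A.trace.re) {α : ℝ} (hα0 : 0 < α) (hα : α < 1) :
    (matPow (matPow B ((1 - α) / (2 * α)) * A *
      matPow B ((1 - α) / (2 * α))) α).trace.re ≤ A.trace.re := by
  have h := trace_matPow_le (posSemidef_sandwich hA B ((1 - α) / (2 * α))) hB
    (by rw [Matrix.mul_assoc, matPow_mul_matPow hB, add_zero]) hα0 hα
  rw [trace_sandwich_mul_matPow A hB hα0.ne'] at h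
  have h1 := mul_le_mul_of_nonneg_left htr (sub_nonneg.2 ((one_le_inv₀ hα0).2 hα.le))
  have h2 := trace_mul_matPow_zero_le hA hB
  exact le_of_mul_le_mul_left (by linarith) (inv_pos.2 hα0)

end MatPow

/-- nonnegativity of the sandwiched Rényi divergence when
`Tr[ρ] ≥ Tr[σ]`, and vanishing when `ρ = σ`. -/
theorem stmt3 {n : ℕ} {α : ℝ} (hα : α ∈ Set.Ioo (0 : ℝ) 1 ∪ Set.Ioi 1)
    {ρ σ : Matrix (Fin n) (Fin n) ℂ}
    (hρ : ρ.PosSemidef) (hσ : σ.PosSemidef) (hρ0 : ρ ≠ 0)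
    (htr : σ.trace.re ≤ ρ.trace.re) :
    0 ≤ Dtilde α ρ σ ∧ (ρ = σ → Dtilde α ρ σ = 0) := by
  have hα0 : 0 < α := by
    rcases hα with h | h
    · exact h.1
    · exact one_pos.trans h
  have hpos : 0 < ρ.trace.re := by
    have h := Complex.le_def.1 hρ.trace_nonneg
    refine lt_of_le_of_ne h.1 fun h0 => hρ0 (hρ.trace_eq_zero_iff.1 ?_)
    exact Complex.ext h0.symm h.2.symm
  constructor
  · unfold Dtilde
    split_ifs with hc
    · rw [EReal.coe_nonneg]
      rcases hα with h | h
      · refine mul_nonneg_of_nonpos_of_nonpos (inv_nonpos.2 (by linarith [h.2])) ?_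
        refine Real.logb_nonpos one_lt_two (div_nonneg ?_ hpos.le) ?_
        · exact trace_matPow_nonneg (posSemidef_sandwich hρ σ _) α
        · exact (div_le_one hpos).2 (trace_sandwich_le_trace hρ hσ htr h.1 h.2)
      · have h : 1 < α := h
        refine mul_nonneg (inv_nonneg.2 (by linarith)) (Real.logb_nonneg one_lt_two ?_)
        exact (one_le_div hpos).2
          (trace_le_trace_sandwich hρ hσ (hc.2.resolve_right h.not_gt) htr h)
    · exact le_top
  · rintro rfl
    have htr2 : (ρ * ρ).trace ≠ 0 := by
      intro h
      rw [← hρ.1.eq] at h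
      nth_rw 2 [hρ.1.eq] at h
      exact hρ0 (Matrix.trace_conjTranspose_mul_self_eq_zero_iff.1 h)
    rw [Dtilde, if_pos ⟨htr2, Or.inl fun _ h => h⟩, matPow_sandwich_self hρ hα0.ne',
      div_self hpos.ne']
    simp
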